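/- Suppose f satisfies Assumption 1. Then there exists a constant C̃(f,k) > 0 depending only on f and k such that for all n ≥ 4(k−1) and all j ≥ 3, the j-th cumulant of the normalized generalized U-statistic satisfies κ_j(S̄_{n,k}(f)) ≤ (j!)^{k+1} / (n C̃(f,k))^{j/2−1}. -/

import Mathlib

open MeasureTheory Finset ProbabilityTheory

/-- The joint cumulant, via the moment–cumulant formula. -/
noncomputable def jointCumulant {Ω : Type*} [MeasurableSpace Ω] (P : Measure Ω)
    {j : ℕ} (Z : Fin j → Ω → ℝ) : ℝ :=
  ∑ σ : Finpartition (Finset.univ : Finset (Fin j)),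
    (-1 : ℝ) ^ (σ.parts.card - 1) * ((σ.parts.card - 1).factorial : ℝ) *
      ∏ b ∈ σ.parts, ∫ ω, ∏ i ∈ b, Z i ω ∂P

/-- The `j`-th cumulant `κ_j(W)` of a random variable `W`. -/
noncomputable def cum {Ω : Type*} [MeasurableSpace Ω] (P : Measure Ω)
    (j : ℕ) (W : Ω → ℝ) : ℝ :=
  jointCumulant P (fun _ : Fin j => W)

/-- The generalized U-statistic
`S_{n,k}(f) = Σ_{β injective} f(X_{β(1)},…,X_{β(k)}, Y_{β(1),β(2)},…,Y_{β(k-1),β(k)})`. -/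
noncomputable def genU {S M Ω : Type*} {k n : ℕ}
    (f : (Fin k → S) → ({q : Fin k × Fin k // q.1 < q.2} → M) → ℝ)
    (X : Fin n → Ω → S) (Y : Fin n → Fin n → Ω → M) (ω : Ω) : ℝ :=
  ∑ β ∈ (Finset.univ : Finset (Fin k → Fin n)).filter Function.Injective,
    f (fun i => X (β i) ω) (fun q => Y (β q.1.1) (β q.1.2) ω)

/-- The projection `f_{(ℓ)}(x) = ∫ f(x_1,…,x_{ℓ−1},x,x_{ℓ+1},…,x_k,y) dμ^{⊗(k−1)} dQ^{⊗k(k−1)/2}`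
(the unused `ℓ`-th coordinate is also integrated out, which is harmless since `μ` is a
probability measure). -/
noncomputable def fProj {S M : Type*} [MeasurableSpace S] [MeasurableSpace M] {k : ℕ}
    (f : (Fin k → S) → ({q : Fin k × Fin k // q.1 < q.2} → M) → ℝ)
    (μ : Measure S) (Q : Measure M) (ℓ : Fin k) (x : S) : ℝ :=
  ∫ z : (Fin k → S) × ({q : Fin k × Fin k // q.1 < q.2} → M),
    f (Function.update z.1 ℓ x) z.2
    ∂((Measure.pi fun _ => μ).prod (Measure.pi fun _ => Q))

/-- The normalized generalized U-statistic
`S̄_{n,k}(f) = (S_{n,k}(f) − E[S_{n,k}(f)])/√Var(S_{n,k}(f))`. -/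
noncomputable def genUbar {S M Ω : Type*} [MeasurableSpace Ω] {k n : ℕ}
    (P : Measure Ω)
    (f : (Fin k → S) → ({q : Fin k × Fin k // q.1 < q.2} → M) → ℝ)
    (X : Fin n → Ω → S) (Y : Fin n → Fin n → Ω → M) (ω : Ω) : ℝ :=
  (genU f X Y ω - ∫ ω', genU f X Y ω' ∂P) / Real.sqrt (variance (genU f X Y) P)

/-- The cumulant-type partition sum of a set function `m`. -/
noncomputable def cumulantSum {ι : Type*} [Fintype ι] [DecidableEq ι] (m : Finset ι → ℝ) : ℝ :=
  ∑ σ : Finpartition (Finset.univ : Finset ι),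
    (-1 : ℝ) ^ (σ.parts.card - 1) * ((σ.parts.card - 1).factorial : ℝ) * ∏ b ∈ σ.parts, m b

/-- The colouring of `ι` that assigns to every point the colour of its block. -/
def Finpartition.colouring {ι : Type*} [Fintype ι] [DecidableEq ι] {x : ℕ}
    (σ : Finpartition (Finset.univ : Finset ι)) (e : σ.parts ↪ Fin x) (i : ι) : Fin x :=
  e ⟨σ.part i, σ.part_mem.2 (Finset.mem_univ i)⟩

lemma Finpartition.filter_colouring {ι : Type*} [Fintype ι] [DecidableEq ι] {x : ℕ}
    (σ : Finpartition (Finset.univ : Finset ι)) (e : σ.parts ↪ Fin x) (b : σ.parts) :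
    Finset.univ.filter (fun i => σ.colouring e i = e b) = b.1 := by
  ext i
  simp only [Finset.mem_filter, Finset.mem_univ, true_and, colouring,
    EmbeddingLike.apply_eq_iff_eq, Subtype.ext_iff]
  exact σ.part_eq_iff_mem b.2

lemma Finpartition.colouring_bijective {ι : Type*} [Fintype ι] [DecidableEq ι] (x : ℕ) :
    Function.Bijective
      (fun p : (σ : Finpartition (Finset.univ : Finset ι)) × (σ.parts ↪ Fin x) =>
        p.1.colouring p.2) := by
  constructor
  · rintro ⟨σ, e⟩ ⟨τ, e'⟩ h
    have h : ∀ i, σ.colouring e i = τ.colouring e' i := fun i => congrFun h i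
    have hpart : ∀ i, σ.part i = τ.part i := by
      intro i
      have h1 := σ.filter_colouring e ⟨σ.part i, σ.part_mem.2 (Finset.mem_univ i)⟩
      have h2 := τ.filter_colouring e' ⟨τ.part i, τ.part_mem.2 (Finset.mem_univ i)⟩
      change _ = σ.part i at h1
      change _ = τ.part i at h2
      rw [← h1, ← h2]
      change Finset.univ.filter (fun i' => σ.colouring e i' = σ.colouring e i) =
        Finset.univ.filter (fun i' => τ.colouring e' i' = τ.colouring e' i)
      simp only [h]
    have hστ : σ = τ := by
      have key : ∀ ρ : Finpartition (Finset.univ : Finset ι),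
          ρ.parts = Finset.univ.image ρ.part := by
        intro ρ
        ext b
        simp only [Finset.mem_image, Finset.mem_univ, true_and]
        constructor
        · intro hb
          obtain ⟨i, hi⟩ := ρ.nonempty_of_mem_parts hb
          exact ⟨i, ρ.part_eq_of_mem hb hi⟩
        · rintro ⟨i, rfl⟩
          exact ρ.part_mem.2 (Finset.mem_univ i)
      apply Finpartition.ext
      rw [key σ, key τ, funext hpart]
    subst hστ
    congr 1
    ext b
    obtain ⟨i, hi⟩ := σ.nonempty_of_mem_parts b.2
    have := h i
    have hb : (⟨σ.part i, σ.part_mem.2 (Finset.mem_univ i)⟩ : σ.parts) = b :=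
      Subtype.ext (σ.part_eq_of_mem b.2 hi)
    simp only [Finpartition.colouring, hb] at this
    rw [this]
  · intro g
    classical
    let σ : Finpartition (Finset.univ : Finset ι) := Finpartition.ofSetoid (Setoid.ker g)
    have hσ : ∀ i i', i' ∈ σ.part i ↔ g i = g i' := fun i i' =>
      Finpartition.mem_part_ofSetoid_iff_rel
    have hne : ∀ b : σ.parts, (b.1).Nonempty := fun b => σ.nonempty_of_mem_parts b.2
    have hpart : ∀ b : σ.parts, σ.part (hne b).choose = b.1 := fun b =>
      σ.part_eq_of_mem b.2 (hne b).choose_spec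
    refine ⟨⟨σ, ⟨fun b => g (hne b).choose, ?_⟩⟩, ?_⟩
    · intro b b' hbb
      have : (hne b').choose ∈ σ.part (hne b).choose := (hσ _ _).2 hbb
      rw [hpart b] at this
      exact Subtype.ext (σ.eq_of_mem_parts b.2 b'.2 this (hne b').choose_spec)
    · funext i
      change g (hne ⟨σ.part i, _⟩).choose = g i
      exact ((hσ _ _).1 (hne ⟨σ.part i, σ.part_mem.2 (Finset.mem_univ i)⟩).choose_spec).symm

lemma sum_prod_fibres_eq {ι : Type*} [Fintype ι] [DecidableEq ι] (m : Finset ι → ℝ)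
    (h0 : m ∅ = 1) (x : ℕ) :
    ∑ g : ι → Fin x, ∏ c, m (Finset.univ.filter fun i => g i = c) =
      ∑ σ : Finpartition (Finset.univ : Finset ι),
        (x.descFactorial σ.parts.card : ℝ) * ∏ b ∈ σ.parts, m b := by
  rw [← (Finpartition.colouring_bijective x).sum_comp, Fintype.sum_sigma]
  refine Finset.sum_congr rfl fun σ _ => ?_
  have : ∀ e : σ.parts ↪ Fin x,
      ∏ c, m (Finset.univ.filter fun i => σ.colouring e i = c) = ∏ b ∈ σ.parts, m b := by
    intro e
    rw [← Finset.prod_subset (Finset.subset_univ (Finset.univ.map e)), Finset.prod_map]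
    · simp only [Finpartition.filter_colouring]
      exact Finset.prod_coe_sort σ.parts m
    · intro c _ hc
      rw [Finset.filter_false_of_mem, h0]
      intro i _ hi
      exact hc (Finset.mem_map.2 ⟨_, Finset.mem_univ _, hi⟩)
  simp only [this, Finset.sum_const, Finset.card_univ, Fintype.card_embedding_eq,
    Fintype.card_coe, Fintype.card_fin, nsmul_eq_mul]

/-- The polynomial interpolating `x ↦ ∑ g : ι → Fin x, ∏ c, m (g ⁻¹ c)`. -/
noncomputable def colouringPoly {ι : Type*} [Fintype ι] [DecidableEq ι] (m : Finset ι → ℝ) :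
    Polynomial ℝ :=
  ∑ σ : Finpartition (Finset.univ : Finset ι),
    Polynomial.C (∏ b ∈ σ.parts, m b) * descPochhammer ℝ σ.parts.card

lemma colouringPoly_eval_natCast {ι : Type*} [Fintype ι] [DecidableEq ι] (m : Finset ι → ℝ)
    (h0 : m ∅ = 1) (x : ℕ) :
    (colouringPoly m).eval (x : ℝ) =
      ∑ g : ι → Fin x, ∏ c, m (Finset.univ.filter fun i => g i = c) := by
  rw [sum_prod_fibres_eq m h0, colouringPoly, Polynomial.eval_finsetSum]
  refine Finset.sum_congr rfl fun σ _ => ?_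
  rw [Polynomial.eval_mul, Polynomial.eval_C, descPochhammer_eval_eq_descFactorial, mul_comm]

lemma Finpartition.parts_card_pos {ι : Type*} [Fintype ι] [DecidableEq ι] [Nonempty ι]
    (σ : Finpartition (Finset.univ : Finset ι)) : 0 < σ.parts.card :=
  Finset.card_pos.2 (σ.parts_nonempty (Finset.univ_nonempty (α := ι)).ne_empty)

lemma coeff_one_descPochhammer_succ (n : ℕ) :
    (descPochhammer ℝ (n + 1)).coeff 1 = (-1) ^ n * (n.factorial : ℝ) := by
  rw [descPochhammer_succ_left, Polynomial.coeff_X_mul, Polynomial.coeff_zero_eq_eval_zero,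
    Polynomial.eval_comp]
  induction n with
  | zero => simp
  | succ n ih =>
    rw [descPochhammer_succ_eval, ih, Nat.factorial_succ]
    simp
    ring

lemma colouringPoly_coeff_one {ι : Type*} [Fintype ι] [DecidableEq ι] [Nonempty ι]
    (m : Finset ι → ℝ) : (colouringPoly m).coeff 1 = cumulantSum m := by
  rw [colouringPoly, Polynomial.finsetSum_coeff, cumulantSum]
  refine Finset.sum_congr rfl fun σ _ => ?_
  obtain ⟨n, hn⟩ := Nat.exists_eq_succ_of_ne_zero σ.parts_card_pos.ne'
  rw [Polynomial.coeff_C_mul, hn, Nat.succ_eq_add_one, coeff_one_descPochhammer_succ]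
  simp
  ring

lemma colouringPoly_coeff_zero {ι : Type*} [Fintype ι] [DecidableEq ι] [Nonempty ι]
    (m : Finset ι → ℝ) : (colouringPoly m).coeff 0 = 0 := by
  rw [colouringPoly, Polynomial.finsetSum_coeff]
  refine Finset.sum_eq_zero fun σ _ => ?_
  rw [Polynomial.coeff_C_mul, Polynomial.coeff_zero_eq_eval_zero,
    descPochhammer_ne_zero_eval_zero _ σ.parts_card_pos.ne', mul_zero]

/-- Partition sums of a set function that factorizes over a nontrivial splitting vanish. -/
lemma cumulantSum_eq_zero_of_factor {ι : Type*} [Fintype ι] [DecidableEq ι] (p : ι → Prop)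
    [DecidablePred p] (hp : ∃ i, p i) (hp' : ∃ i, ¬ p i) (m : Finset ι → ℝ)
    (mA : Finset {i // p i} → ℝ) (mB : Finset {i // ¬ p i} → ℝ) (hA : mA ∅ = 1) (hB : mB ∅ = 1)
    (hm : ∀ b, m b = mA (b.subtype p) * mB (b.subtype fun i => ¬ p i)) :
    cumulantSum m = 0 := by
  have : Nonempty {i // p i} := let ⟨i, hi⟩ := hp; ⟨⟨i, hi⟩⟩
  have : Nonempty {i // ¬ p i} := let ⟨i, hi⟩ := hp'; ⟨⟨i, hi⟩⟩
  have : Nonempty ι := let ⟨i, _⟩ := hp; ⟨i⟩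
  have hmul : colouringPoly m = colouringPoly mA * colouringPoly mB := by
    refine Polynomial.eq_of_infinite_eval_eq _ _
      ((Set.infinite_range_of_injective (Nat.cast_injective (R := ℝ))).mono ?_)
    rintro _ ⟨x, rfl⟩
    have h0 : m ∅ = 1 := by
      rw [hm, show (∅ : Finset ι).subtype p = ∅ from rfl,
        show ((∅ : Finset ι).subtype fun i => ¬ p i) = ∅ from rfl, hA, hB, mul_one]
    rw [Set.mem_ofPred_eq, Polynomial.eval_mul, colouringPoly_eval_natCast m h0,
      colouringPoly_eval_natCast mA hA, colouringPoly_eval_natCast mB hB, Finset.sum_mul_sum,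
      ← Fintype.sum_prod_type',
      ← (Equiv.piEquivPiSubtypeProd p fun _ => Fin x).sum_comp]
    refine Finset.sum_congr rfl fun g _ => ?_
    rw [← Finset.prod_mul_distrib]
    refine Finset.prod_congr rfl fun c _ => ?_
    rw [hm]
    congr 2 <;> ext i <;> simp [Equiv.piEquivPiSubtypeProd]
  rw [← colouringPoly_coeff_one, hmul, Polynomial.mul_coeff_one, colouringPoly_coeff_zero,
    colouringPoly_coeff_zero]
  simp

lemma sum_factorial_parts_card_le {ι : Type*} [Fintype ι] [DecidableEq ι] :
    ∑ σ : Finpartition (Finset.univ : Finset ι), ((σ.parts.card - 1).factorial : ℝ) ≤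
      (Fintype.card ι : ℝ) ^ Fintype.card ι := by
  have h := sum_prod_fibres_eq (ι := ι) (fun _ => 1) rfl (Fintype.card ι)
  simp only [Finset.prod_const_one, Finset.sum_const, Finset.card_univ, Fintype.card_fun,
    Fintype.card_fin, nsmul_eq_mul, mul_one, Nat.cast_pow] at h
  rw [h]
  refine Finset.sum_le_sum fun σ _ => ?_
  have hle : σ.parts.card ≤ Fintype.card ι := σ.card_parts_le_card
  have h1 : σ.parts.card.factorial ≤ (Fintype.card ι).descFactorial σ.parts.card := by
    rw [Nat.descFactorial_eq_factorial_mul_choose]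
    exact Nat.le_mul_of_pos_right _ (Nat.choose_pos hle)
  exact_mod_cast (Nat.factorial_le (Nat.sub_le _ 1)).trans h1

lemma abs_cumulantSum_le {ι : Type*} [Fintype ι] [DecidableEq ι] (m : Finset ι → ℝ) {A : ℝ}
    (hm : ∀ b, |m b| ≤ A ^ b.card) :
    |cumulantSum m| ≤ (Fintype.card ι : ℝ) ^ Fintype.card ι * A ^ Fintype.card ι := by
  have hterm : ∀ σ : Finpartition (Finset.univ : Finset ι),
      |∏ b ∈ σ.parts, m b| ≤ A ^ Fintype.card ι := by
    intro σ
    rw [Finset.abs_prod]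
    calc ∏ b ∈ σ.parts, |m b| ≤ ∏ b ∈ σ.parts, A ^ b.card :=
          Finset.prod_le_prod (fun _ _ => abs_nonneg _) fun b _ => hm b
      _ = A ^ Fintype.card ι := by
          rw [Finset.prod_pow_eq_pow_sum, σ.sum_card_parts, Finset.card_univ]
  calc |cumulantSum m|
      ≤ ∑ σ : Finpartition (Finset.univ : Finset ι),
          ((σ.parts.card - 1).factorial : ℝ) * A ^ Fintype.card ι := by
        refine (Finset.abs_sum_le_sum_abs _ _).trans (Finset.sum_le_sum fun σ _ => ?_)
        rw [abs_mul, abs_mul, abs_pow, abs_neg, abs_one, one_pow, one_mul, Nat.abs_cast]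
        exact mul_le_mul_of_nonneg_left (hterm σ) (Nat.cast_nonneg _)
    _ ≤ _ := by
        rw [← Finset.sum_mul]
        refine mul_le_mul_of_nonneg_right sum_factorial_parts_card_le ?_
        exact (abs_nonneg _).trans (hterm ⊤)

/-- Counting sequences in which every entry is adjacent to an earlier one. -/
lemma card_attached_le {V : Type*} [Fintype V] [DecidableEq V] (adj : V → V → Prop)
    [DecidableRel adj] {D : ℕ} (hD : ∀ v, (Finset.univ.filter (adj v)).card ≤ D) (m : ℕ) :
    (Finset.univ.filter fun γ : Fin (m + 1) → V =>
      ∀ i, i ≠ 0 → ∃ i' < i, adj (γ i') (γ i)).card ≤ Fintype.card V * D ^ m * m.factorial := by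
  induction m with
  | zero =>
    refine (Finset.card_filter_le _ _).trans ?_
    simp
  | succ m ih =>
    set s := Finset.univ.filter fun γ : Fin (m + 2) → V =>
      ∀ i, i ≠ 0 → ∃ i' < i, adj (γ i') (γ i) with hs
    let φ : (Fin (m + 2) → V) → (Fin (m + 1) → V) := fun γ i => γ i.castSucc
    have h1 : s.card ≤ ((m + 1) * D) * (s.image φ).card := by
      refine Finset.card_le_mul_card_image s _ fun γ₀ _ => ?_
      have hinj : Set.InjOn (fun γ : Fin (m + 2) → V => γ (Fin.last (m + 1)))
          (s.filter fun γ => φ γ = γ₀ : Finset (Fin (m + 2) → V)) := by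
        intro γ hγ γ' hγ' h
        have hγ := (Finset.mem_filter.1 (Finset.mem_coe.1 hγ)).2
        have hγ' := (Finset.mem_filter.1 (Finset.mem_coe.1 hγ')).2
        funext i
        refine Fin.lastCases h (fun i => ?_) i
        exact congrFun (hγ.trans hγ'.symm) i
      calc (s.filter fun γ => φ γ = γ₀).card
          ≤ (Finset.univ.biUnion fun i : Fin (m + 1) => Finset.univ.filter (adj (γ₀ i))).card := by
            refine Finset.card_le_card_of_injOn _ ?_ hinj
            intro γ hγ
            obtain ⟨hγs, hγ⟩ := Finset.mem_filter.1 (Finset.mem_coe.1 hγ)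
            obtain ⟨i', hi', hadj⟩ := (Finset.mem_filter.1 hγs).2 (Fin.last (m + 1))
              (Fin.last_pos.ne')
            simp only [Finset.coe_biUnion, Set.mem_iUnion, Finset.mem_coe, Finset.mem_univ,
              Finset.mem_filter, true_and, exists_prop]
            refine ⟨i'.castPred hi'.ne, ?_⟩
            rw [← hγ]
            simpa [φ] using hadj
        _ ≤ ∑ i : Fin (m + 1), (Finset.univ.filter (adj (γ₀ i))).card := Finset.card_biUnion_le
        _ ≤ ∑ _i : Fin (m + 1), D := Finset.sum_le_sum fun i _ => hD _
        _ = (m + 1) * D := by simp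
    have h2 : (s.image φ).card ≤ Fintype.card V * D ^ m * m.factorial := by
      refine (Finset.card_le_card ?_).trans ih
      intro γ₀ hγ₀
      obtain ⟨γ, hγ, rfl⟩ := Finset.mem_image.1 hγ₀
      simp only [Finset.mem_filter, Finset.mem_univ, true_and]
      intro i hi
      obtain ⟨i', hi', hadj⟩ := (Finset.mem_filter.1 hγ).2 i.castSucc
        (fun h => hi (Fin.castSucc_injective _ (h.trans Fin.castSucc_zero.symm)))
      refine ⟨i'.castPred (hi'.trans (Fin.castSucc_lt_last i)).ne, ?_, ?_⟩
      · rw [Fin.lt_def] at hi' ⊢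
        simpa using hi'
      · simpa [φ] using hadj
    calc s.card ≤ ((m + 1) * D) * (s.image φ).card := h1
      _ ≤ ((m + 1) * D) * (Fintype.card V * D ^ m * m.factorial) := Nat.mul_le_mul_left _ h2
      _ = Fintype.card V * D ^ (m + 1) * (m + 1).factorial := by
        rw [Nat.factorial_succ, pow_succ]; ring

/-- The family `β` does not split into two nonempty subfamilies without adjacencies. -/
def ConnectedFamily {ι V : Type*} (adj : V → V → Prop) (β : ι → V) : Prop :=
  ∀ p : ι → Prop, (∃ i, p i) → (∃ i, ¬ p i) → ∃ i i', p i ∧ ¬ p i' ∧ adj (β i) (β i')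

lemma ConnectedFamily.exists_perm {V : Type*} {adj : V → V → Prop} {m : ℕ}
    {β : Fin (m + 1) → V} (hβ : ConnectedFamily adj β) :
    ∃ e : Equiv.Perm (Fin (m + 1)), ∀ i, i ≠ 0 → ∃ i' < i, adj (β (e i')) (β (e i)) := by
  have key : ∀ l ≤ m, ∃ e : Fin (l + 1) → Fin (m + 1), Function.Injective e ∧
      ∀ i, i ≠ 0 → ∃ i' < i, adj (β (e i')) (β (e i)) := by
    intro l
    induction l with
    | zero =>
      intro _
      exact ⟨fun _ => 0, fun a b _ => Fin.ext (by omega),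
        fun i hi => absurd (Fin.ext (by simp only [Fin.val_zero]; omega)) hi⟩
    | succ l ih =>
      intro hl
      obtain ⟨e, he, hadj⟩ := ih (by omega)
      obtain ⟨i, i', ⟨a, rfl⟩, hi', hii'⟩ := hβ (fun i => i ∈ Set.range e) ⟨e 0, 0, rfl⟩ (by
        by_contra! h
        have := Fintype.card_le_of_surjective e h
        simp only [Fintype.card_fin] at this
        omega)
      refine ⟨Fin.snoc (α := fun _ => Fin (m + 1)) e i', ?_, ?_⟩
      · exact Fin.snoc_injective_iff.2 ⟨he, hi'⟩
      · intro b
        refine Fin.lastCases (fun _ => ⟨a.castSucc, Fin.castSucc_lt_last a, ?_⟩) (fun b hb => ?_) b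
        · simpa using hii'
        · obtain ⟨c, hc, hcb⟩ := hadj b (fun h => hb (by simp [h]))
          exact ⟨c.castSucc, Fin.castSucc_lt_castSucc_iff.2 hc, by simpa using hcb⟩
  obtain ⟨e, he, hadj⟩ := key m le_rfl
  exact ⟨Equiv.ofBijective e (Finite.injective_iff_bijective.1 he), hadj⟩

open Classical in
lemma card_connectedFamily_le {V : Type*} [Fintype V] (adj : V → V → Prop) {D : ℕ}
    (hD : ∀ v, (Finset.univ.filter (adj v)).card ≤ D) (m : ℕ) :
    (Finset.univ.filter fun β : Fin (m + 1) → V => ConnectedFamily adj β).card ≤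
      (m + 1).factorial * (Fintype.card V * D ^ m * m.factorial) := by
  set s := Finset.univ.filter fun γ : Fin (m + 1) → V =>
      ∀ i, i ≠ 0 → ∃ i' < i, adj (γ i') (γ i) with hs
  calc (Finset.univ.filter fun β : Fin (m + 1) → V => ConnectedFamily adj β).card
      ≤ ((Finset.univ : Finset (Equiv.Perm (Fin (m + 1)))).biUnion fun e =>
          s.image fun γ => γ ∘ e.symm).card := by
        refine Finset.card_le_card fun β hβ => ?_
        obtain ⟨e, he⟩ := (Finset.mem_filter.1 hβ).2.exists_perm
        simp only [Finset.mem_biUnion, Finset.mem_univ, true_and, Finset.mem_image]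
        refine ⟨e, β ∘ e, by simpa [hs] using he, ?_⟩
        funext i
        simp
    _ ≤ ∑ e : Equiv.Perm (Fin (m + 1)), (s.image fun γ => γ ∘ e.symm).card :=
        Finset.card_biUnion_le
    _ ≤ ∑ _e : Equiv.Perm (Fin (m + 1)), Fintype.card V * D ^ m * m.factorial :=
        Finset.sum_le_sum fun e _ => Finset.card_image_le.trans (card_attached_le adj hD m)
    _ = _ := by simp [Fintype.card_perm]

/-- Two index tuples share an index. -/
def Meets {k n : ℕ} (v w : Fin k → Fin n) : Prop := ∃ a b, v a = w b

open Classical in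
lemma card_meets_le {k n : ℕ} (v : Fin k → Fin n) :
    (Finset.univ.filter fun w : Fin k → Fin n => Meets v w).card ≤ k ^ 2 * n ^ (k - 1) := by
  have hfix : ∀ (b : Fin k) (c : Fin n),
      (Fintype.piFinset fun i : Fin k => if i = b then {c} else Finset.univ).card
        = n ^ (k - 1) := by
    intro b c
    rw [Fintype.card_piFinset, ← Finset.mul_prod_erase _ _ (Finset.mem_univ b),
      Finset.prod_congr rfl (g := fun _ => n)
        (fun i hi => by rw [if_neg (Finset.ne_of_mem_erase hi)]; simp)]
    simp
  calc (Finset.univ.filter fun w : Fin k → Fin n => Meets v w).card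
      ≤ ((Finset.univ : Finset (Fin k × Fin k)).biUnion fun ab =>
          Fintype.piFinset fun i : Fin k => if i = ab.2 then {v ab.1} else Finset.univ).card := by
        refine Finset.card_le_card fun w hw => ?_
        obtain ⟨a, b, hab⟩ := (Finset.mem_filter.1 hw).2
        refine Finset.mem_biUnion.2 ⟨(a, b), Finset.mem_univ _, Fintype.mem_piFinset.2 fun i => ?_⟩
        by_cases h : i = b
        · subst h; simp [hab]
        · simp [h]
    _ ≤ ∑ ab : Fin k × Fin k, n ^ (k - 1) :=
        Finset.card_biUnion_le.trans (Finset.sum_le_sum fun ab _ => (hfix _ _).le)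
    _ = _ := by simp [sq]

lemma Finpartition.prod_integral_eq {ι Ω : Type*} [Fintype ι] [DecidableEq ι] [MeasurableSpace Ω]
    (P : Measure Ω) [IsProbabilityMeasure P] (σ : Finpartition (Finset.univ : Finset ι))
    (W : ι → Ω → ℝ) :
    ∏ b ∈ σ.parts, ∫ ω, ∏ i ∈ b, W i ω ∂P =
      ∫ ω : σ.parts → Ω, ∏ i, W i (ω ⟨σ.part i, σ.part_mem.2 (Finset.mem_univ i)⟩)
        ∂(Measure.pi fun _ => P) := by
  rw [← Finset.prod_coe_sort σ.parts fun b => ∫ ω, ∏ i ∈ b, W i ω ∂P,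
    ← integral_fintype_prod_eq_prod (fun (b : σ.parts) ω => ∏ i ∈ b.1, W i ω)]
  congr 1
  funext ω
  rw [← Finset.prod_fiberwise (Finset.univ : Finset ι)
    (fun i => (⟨σ.part i, σ.part_mem.2 (Finset.mem_univ i)⟩ : σ.parts))]
  refine Finset.prod_congr rfl fun b _ => ?_
  have hb : (Finset.univ.filter fun i =>
      (⟨σ.part i, σ.part_mem.2 (Finset.mem_univ i)⟩ : σ.parts) = b) = b.1 := by
    ext i
    simp only [Finset.mem_filter, Finset.mem_univ, true_and, Subtype.ext_iff]
    exact σ.part_eq_iff_mem b.2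
  rw [hb]
  refine Finset.prod_congr rfl fun i hi => ?_
  congr
  exact (Subtype.ext ((σ.part_eq_iff_mem b.2).2 hi)).symm

lemma abs_prod_le_pow {ι : Type*} (s : Finset ι) (F : ι → ℝ) {A : ℝ} (h : ∀ i, |F i| ≤ A) :
    |∏ i ∈ s, F i| ≤ A ^ s.card := by
  rw [Finset.abs_prod]
  exact (Finset.prod_le_prod (fun _ _ => abs_nonneg _) fun i _ => h i).trans (by simp)

/-- Multilinear expansion of the cumulant of a finite sum. -/
lemma cumulantSum_sum_expand {ι V Ω : Type*} [Fintype ι] [DecidableEq ι] [Fintype V]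
    [MeasurableSpace Ω] (P : Measure Ω) [IsProbabilityMeasure P] (Z : V → Ω → ℝ)
    (hZ : ∀ v, Measurable (Z v)) {A : ℝ} (hA : ∀ v ω, |Z v ω| ≤ A) :
    cumulantSum (fun b : Finset ι => ∫ ω, ∏ _i ∈ b, ∑ v, Z v ω ∂P) =
      ∑ β : ι → V, cumulantSum (fun b : Finset ι => ∫ ω, ∏ i ∈ b, Z (β i) ω ∂P) := by
  classical
  simp only [cumulantSum]
  rw [Finset.sum_comm]
  refine Finset.sum_congr rfl fun σ _ => ?_
  rw [← Finset.mul_sum]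
  congr 1
  rw [σ.prod_integral_eq P (fun _ ω => ∑ v, Z v ω)]
  simp only [fun β : ι → V => σ.prod_integral_eq P (fun i => Z (β i))]
  rw [← integral_finsetSum]
  · congr 1
    funext ω
    rw [Finset.prod_univ_sum, Fintype.piFinset_univ]
  · intro β _
    refine Integrable.of_bound (C := A ^ (Finset.univ : Finset ι).card) ?_ ?_
    · refine Measurable.aestronglyMeasurable ?_
      exact Finset.measurable_fun_prod _ fun i _ => (hZ (β i)).comp (measurable_pi_apply _)
    · exact Filter.Eventually.of_forall fun ω => abs_prod_le_pow _ _ fun i => hA _ _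

lemma integral_mul_of_dependsOn_pi {ι S : Type*} [Fintype ι] [MeasurableSpace S]
    (μ : Measure S) [IsProbabilityMeasure μ] {F G : (ι → S) → ℝ} (hF : Measurable F)
    (hG : Measurable G) (U : Set ι) (hFU : DependsOn F U) (hGU : DependsOn G Uᶜ) :
    ∫ x, F x * G x ∂(Measure.pi fun _ => μ) =
      (∫ x, F x ∂(Measure.pi fun _ => μ)) * ∫ x, G x ∂(Measure.pi fun _ => μ) := by
  classical
  obtain ⟨s₀⟩ : Nonempty S := nonempty_of_isProbabilityMeasure μ
  have hind : iIndepFun (fun (i : ι) (x : ι → S) => x i) (Measure.pi fun _ : ι => μ) :=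
    iIndepFun_pi (X := fun _ => id) fun _ => aemeasurable_id
  have h := hind.indepFun_finset U.toFinset U.toFinsetᶜ disjoint_compl_right
    (fun i => measurable_pi_apply i)
  let ext (T : Finset ι) (z : T → S) : ι → S := fun i => if hi : i ∈ T then z ⟨i, hi⟩ else s₀
  have hext : ∀ T, Measurable (ext T) := by
    intro T
    refine measurable_pi_lambda _ fun i => ?_
    by_cases hi : i ∈ T
    · simpa [ext, hi] using measurable_pi_apply _
    · simp [ext, hi]
  have h2 := h.comp (hF.comp (hext _)) (hG.comp (hext _))
  have hF' : (F ∘ ext U.toFinset) ∘ (fun (x : ι → S) (i : U.toFinset) => x i) = F := by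
    funext x
    refine hFU fun i hi => ?_
    simp [ext, hi]
  have hG' : (G ∘ ext U.toFinsetᶜ) ∘
      (fun (x : ι → S) (i : (U.toFinsetᶜ : Finset ι)) => x i) = G := by
    funext x
    refine hGU fun i hi => ?_
    simp only [Set.mem_compl_iff] at hi
    simp [ext, hi]
  rw [hF', hG'] at h2
  exact h2.integral_fun_mul_eq_mul_integral hF.aestronglyMeasurable hG.aestronglyMeasurable

/-- Bounded functions of disjoint blocks of coordinates are uncorrelated under a product of two
product measures. -/
lemma integral_mul_of_dependsOn {ι κ S M : Type*} [Fintype ι] [Fintype κ] [MeasurableSpace S]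
    [MeasurableSpace M] (μ : Measure S) [IsProbabilityMeasure μ] (Q : Measure M)
    [IsProbabilityMeasure Q] {F G : (ι → S) × (κ → M) → ℝ} (hF : Measurable F)
    (hG : Measurable G) {A B : ℝ} (hA : ∀ z, |F z| ≤ A) (hB : ∀ z, |G z| ≤ B)
    (U : Set ι) (V : Set κ)
    (hFU : ∀ x x' y y', (∀ i ∈ U, x i = x' i) → (∀ q ∈ V, y q = y' q) → F (x, y) = F (x', y'))
    (hGU : ∀ x x' y y', (∀ i ∉ U, x i = x' i) → (∀ q ∉ V, y q = y' q) → G (x, y) = G (x', y')) :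
    ∫ z, F z * G z ∂((Measure.pi fun _ => μ).prod (Measure.pi fun _ => Q)) =
      (∫ z, F z ∂((Measure.pi fun _ => μ).prod (Measure.pi fun _ => Q))) *
        ∫ z, G z ∂((Measure.pi fun _ => μ).prod (Measure.pi fun _ => Q)) := by
  have hFi : Integrable F ((Measure.pi fun _ => μ).prod (Measure.pi fun _ => Q)) :=
    Integrable.of_bound hF.aestronglyMeasurable A (Filter.Eventually.of_forall hA)
  have hGi : Integrable G ((Measure.pi fun _ => μ).prod (Measure.pi fun _ => Q)) :=
    Integrable.of_bound hG.aestronglyMeasurable B (Filter.Eventually.of_forall hB)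
  have hFGi : Integrable (fun z => F z * G z)
      ((Measure.pi fun _ => μ).prod (Measure.pi fun _ => Q)) := by
    refine Integrable.of_bound (hF.mul hG).aestronglyMeasurable (A * B)
      (Filter.Eventually.of_forall fun z => ?_)
    rw [Real.norm_eq_abs, abs_mul]
    exact mul_le_mul (hA z) (hB z) (abs_nonneg _) ((abs_nonneg _).trans (hA z))
  rw [integral_prod _ hFGi, integral_prod _ hFi, integral_prod _ hGi]
  have hinner : ∀ x : ι → S, ∫ y, F (x, y) * G (x, y) ∂(Measure.pi fun _ : κ => Q) =
      (∫ y, F (x, y) ∂(Measure.pi fun _ => Q)) * ∫ y, G (x, y) ∂(Measure.pi fun _ => Q) :=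
    fun x => integral_mul_of_dependsOn_pi Q (hF.comp measurable_prodMk_left)
      (hG.comp measurable_prodMk_left) V (fun y y' h => hFU x x y y' (fun _ _ => rfl) h)
      (fun y y' h => hGU x x y y' (fun _ _ => rfl) h)
  simp only [hinner]
  refine integral_mul_of_dependsOn_pi μ ?_ ?_ U ?_ ?_
  · exact (hF.stronglyMeasurable.integral_prod_right').measurable
  · exact (hG.stronglyMeasurable.integral_prod_right').measurable
  · intro x x' h
    exact integral_congr_ae (Filter.Eventually.of_forall fun y =>
      hFU x x' y y h fun _ _ => rfl)
  · intro x x' h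
    exact integral_congr_ae (Filter.Eventually.of_forall fun y =>
      hGU x x' y y h fun _ _ => rfl)

/-- The increasing pair spanned by the images of `q` under an injective tuple. -/
def sortPair {k n : ℕ} (v : Fin k → Fin n) (hv : Function.Injective v)
    (q : {q : Fin k × Fin k // q.1 < q.2}) : {q : Fin n × Fin n // q.1 < q.2} :=
  ⟨(min (v q.1.1) (v q.1.2), max (v q.1.1) (v q.1.2)),
    min_lt_max.2 fun h => q.2.ne (hv h)⟩

lemma sortPair_injective {k n : ℕ} (v : Fin k → Fin n) (hv : Function.Injective v) :
    Function.Injective (sortPair v hv) := by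
  rintro ⟨⟨a, b⟩, hab⟩ ⟨⟨c, d⟩, hcd⟩ h
  simp only [sortPair, Subtype.mk.injEq, Prod.mk.injEq] at h
  obtain ⟨h1, h2⟩ := h
  have : (v a = v c ∧ v b = v d) ∨ (v a = v d ∧ v b = v c) := by
    rcases le_total (v a) (v b) with h | h <;> rcases le_total (v c) (v d) with h' | h' <;>
      simp_all
  rcases this with ⟨h3, h4⟩ | ⟨h3, h4⟩
  · simp [hv h3, hv h4]
  · have h3 := hv h3
    have h4 := hv h4
    simp only at hab hcd
    subst h3 h4
    exact absurd hab hcd.asymm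

/-- A summand of the generalized U-statistic on the canonical space, zero for tuples that are not
injective. -/
noncomputable def kernelTerm {S M : Type*} {k n : ℕ}
    (f : (Fin k → S) → ({q : Fin k × Fin k // q.1 < q.2} → M) → ℝ) (v : Fin k → Fin n)
    (z : (Fin n → S) × ({q : Fin n × Fin n // q.1 < q.2} → M)) : ℝ :=
  open Classical in
  if hv : Function.Injective v then f (fun i => z.1 (v i)) (fun q => z.2 (sortPair v hv q)) else 0

/-- The joint law of `n` vertex variables and their edge variables. -/
noncomputable abbrev graphLaw {S M : Type*} [MeasurableSpace S] [MeasurableSpace M]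
    (μ : Measure S) (Q : Measure M) (n : ℕ) :
    Measure ((Fin n → S) × ({q : Fin n × Fin n // q.1 < q.2} → M)) :=
  (Measure.pi fun _ => μ).prod (Measure.pi fun _ => Q)

lemma genU_eq_sum_kernelTerm {S M Ω : Type*} {k n : ℕ}
    (f : (Fin k → S) → ({q : Fin k × Fin k // q.1 < q.2} → M) → ℝ)
    (X : Fin n → Ω → S) (Y : Fin n → Fin n → Ω → M) (hY : ∀ a b, Y a b = Y b a) (ω : Ω) :
    genU f X Y ω = ∑ v, kernelTerm f v ((fun i => X i ω),
      (fun q : {q : Fin n × Fin n // q.1 < q.2} => Y q.1.1 q.1.2 ω)) := by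
  rw [genU, Finset.sum_filter]
  refine Finset.sum_congr rfl fun v _ => ?_
  rw [kernelTerm]
  by_cases hv : Function.Injective v
  · rw [if_pos hv, dif_pos hv]
    congr 1
    funext q
    simp only [sortPair]
    rcases le_total (v q.1.1) (v q.1.2) with h | h
    · rw [min_eq_left h, max_eq_right h]
    · rw [min_eq_right h, max_eq_left h, hY]
  · rw [if_neg hv, dif_neg hv]

lemma measurable_kernelTerm {S M : Type*} [MeasurableSpace S]
    [MeasurableSpace M] {k n : ℕ}
    {f : (Fin k → S) → ({q : Fin k × Fin k // q.1 < q.2} → M) → ℝ}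
    (hf : Measurable fun z : (Fin k → S) × ({q : Fin k × Fin k // q.1 < q.2} → M) => f z.1 z.2)
    (v : Fin k → Fin n) : Measurable (kernelTerm f v) := by
  by_cases hv : Function.Injective v
  · have : kernelTerm f v = fun z => (fun z : (Fin k → S) ×
        ({q : Fin k × Fin k // q.1 < q.2} → M) => f z.1 z.2)
        ((fun i => z.1 (v i)), fun q => z.2 (sortPair v hv q)) := by
      funext z
      rw [kernelTerm, dif_pos hv]
    rw [this]
    exact hf.comp (by fun_prop)
  · have : kernelTerm f v = fun z => (0 : ℝ) := by
      funext z
      rw [kernelTerm, dif_neg hv]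
    rw [this]
    exact measurable_const

lemma abs_kernelTerm_le {S M : Type*} {k n : ℕ}
    {f : (Fin k → S) → ({q : Fin k × Fin k // q.1 < q.2} → M) → ℝ} {C : ℝ}
    (hC : ∀ x y, |f x y| ≤ C) (hC0 : 0 ≤ C) (v : Fin k → Fin n)
    (z : (Fin n → S) × ({q : Fin n × Fin n // q.1 < q.2} → M)) : |kernelTerm f v z| ≤ C := by
  rw [kernelTerm]
  split_ifs
  · exact hC _ _
  · simpa using hC0

lemma kernelTerm_congr {S M : Type*} {k n : ℕ}
    {f : (Fin k → S) → ({q : Fin k × Fin k // q.1 < q.2} → M) → ℝ}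
    (v : Fin k → Fin n) {x x' : Fin n → S}
    {y y' : {q : Fin n × Fin n // q.1 < q.2} → M} (hx : ∀ i, x (v i) = x' (v i))
    (hy : ∀ q, q.1.1 ∈ Set.range v → q.1.2 ∈ Set.range v → y q = y' q) :
    kernelTerm f v (x, y) = kernelTerm f v (x', y') := by
  rw [kernelTerm, kernelTerm]
  split_ifs with hv
  · simp only [hx]
    congr 1
    funext q
    refine hy _ ?_ ?_
    · rcases min_choice (v q.1.1) (v q.1.2) with h | h <;> simp [sortPair, h]
    · rcases max_choice (v q.1.1) (v q.1.2) with h | h <;> simp [sortPair, h]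
  · rfl

lemma measurePreserving_pi_comp {ι κ S : Type*} [Fintype ι] [Fintype κ] [MeasurableSpace S]
    (μ : Measure S) [IsProbabilityMeasure μ] (v : κ → ι) (hv : Function.Injective v) :
    MeasurePreserving (fun (x : ι → S) (i : κ) => x (v i)) (Measure.pi fun _ => μ)
      (Measure.pi fun _ => μ) := by
  have hind : iIndepFun (fun (i : ι) (x : ι → S) => x i) (Measure.pi fun _ : ι => μ) :=
    iIndepFun_pi (X := fun _ => id) fun _ => aemeasurable_id
  have h := (iIndepFun_iff_map_fun_eq_pi_map
    (fun i => (measurable_pi_apply (v i)).aemeasurable)).1 (hind.precomp hv)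
  refine ⟨by fun_prop, ?_⟩
  have h2 : ∀ i, Measure.map (fun x : ι → S => x (v i)) (Measure.pi fun _ : ι => μ) = μ :=
    fun i => (measurePreserving_eval (fun _ : ι => μ) (v i)).map_eq
  simp only [h2] at h
  exact h

lemma measurable_update_pair {ι S : Type*} [DecidableEq ι] [MeasurableSpace S] (ℓ : ι) :
    Measurable fun p : S × (ι → S) => Function.update p.2 ℓ p.1 := by
  refine measurable_pi_lambda _ fun i => ?_
  by_cases h : i = ℓ
  · subst h
    simpa using measurable_fst
  · simp only [Function.update_of_ne h]
    fun_prop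

lemma measurePreserving_update {ι S : Type*} [Fintype ι] [DecidableEq ι] [MeasurableSpace S]
    (μ : Measure S) [IsProbabilityMeasure μ] (ℓ : ι) :
    MeasurePreserving (fun p : S × (ι → S) => Function.update p.2 ℓ p.1)
      (μ.prod (Measure.pi fun _ => μ)) (Measure.pi fun _ => μ) := by
  refine ⟨measurable_update_pair ℓ, (Measure.pi_eq fun A hA => ?_).symm⟩
  rw [Measure.map_apply (measurable_update_pair ℓ) (MeasurableSet.univ_pi hA)]
  have : (fun p : S × (ι → S) => Function.update p.2 ℓ p.1) ⁻¹' Set.univ.pi A =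
      A ℓ ×ˢ Set.univ.pi (Function.update A ℓ Set.univ) := by
    ext p
    simp only [Set.mem_preimage, Set.mem_pi, Set.mem_univ, true_implies, Set.mem_prod]
    constructor
    · intro h
      refine ⟨by simpa using h ℓ, fun i => ?_⟩
      by_cases hi : i = ℓ
      · subst hi; simp
      · simpa [hi] using h i
    · rintro ⟨h1, h2⟩ i
      by_cases hi : i = ℓ
      · subst hi; simpa using h1
      · simpa [hi] using h2 i
  rw [this, Measure.prod_prod, Measure.pi_pi, ← Finset.mul_prod_erase _ _ (Finset.mem_univ ℓ),
    ← Finset.mul_prod_erase _ (fun i => μ (A i)) (Finset.mem_univ ℓ)]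
  simp only [Function.update_self, measure_univ, one_mul]
  congr 1
  refine Finset.prod_congr rfl fun i hi => ?_
  rw [Function.update_of_ne (Finset.ne_of_mem_erase hi)]

section Projection

variable {S M : Type*} [MeasurableSpace S] [MeasurableSpace M] {k n : ℕ}
  {f : (Fin k → S) → ({q : Fin k × Fin k // q.1 < q.2} → M) → ℝ} {C : ℝ}
  (μ : Measure S) [IsProbabilityMeasure μ] (Q : Measure M) [IsProbabilityMeasure Q]

lemma measurePreserving_updateFst (ℓ : Fin k) :
    MeasurePreserving (fun p : S × ((Fin k → S) × ({q : Fin k × Fin k // q.1 < q.2} → M)) =>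
      (Function.update p.2.1 ℓ p.1, p.2.2)) (μ.prod (graphLaw μ Q k)) (graphLaw μ Q k) := by
  have h1 := (measurePreserving_update μ ℓ).prod
    (MeasurePreserving.id (Measure.pi fun _ : {q : Fin k × Fin k // q.1 < q.2} => Q))
  have h2 := (measurePreserving_prodAssoc μ (Measure.pi fun _ : Fin k => μ)
    (Measure.pi fun _ : {q : Fin k × Fin k // q.1 < q.2} => Q)).symm
  exact h1.comp h2

lemma measurable_fProj
    (hf : Measurable fun z : (Fin k → S) × ({q : Fin k × Fin k // q.1 < q.2} → M) => f z.1 z.2)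
    (ℓ : Fin k) : Measurable (fProj f μ Q ℓ) :=
  ((hf.comp (measurePreserving_updateFst μ Q ℓ).measurable).stronglyMeasurable.integral_prod_right'
    (ν := graphLaw μ Q k)).measurable

lemma abs_fProj_le (hC : ∀ x y, |f x y| ≤ C) (ℓ : Fin k) (x : S) : |fProj f μ Q ℓ x| ≤ C := by
  have := norm_integral_le_of_norm_le_const (μ := graphLaw μ Q k)
    (f := fun z => f (Function.update z.1 ℓ x) z.2) (C := C)
    (Filter.Eventually.of_forall fun z => hC _ _)
  exact this.trans_eq (by simp)

lemma integral_mul_coord_eq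
    (hf : Measurable fun z : (Fin k → S) × ({q : Fin k × Fin k // q.1 < q.2} → M) => f z.1 z.2)
    (hC : ∀ x y, |f x y| ≤ C) (ℓ : Fin k) {h : S → ℝ} (hh : Measurable h) {B : ℝ}
    (hB : ∀ x, |h x| ≤ B) :
    ∫ z, f z.1 z.2 * h (z.1 ℓ) ∂(graphLaw μ Q k) = ∫ x, fProj f μ Q ℓ x * h x ∂μ := by
  have hmp := measurePreserving_updateFst μ Q ℓ
  have hmeas : Measurable fun z : (Fin k → S) × ({q : Fin k × Fin k // q.1 < q.2} → M) =>
      f z.1 z.2 * h (z.1 ℓ) := hf.mul (hh.comp (by fun_prop))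
  rw [← hmp.map_eq, integral_map hmp.measurable.aemeasurable hmeas.aestronglyMeasurable,
    integral_prod]
  · refine integral_congr_ae (Filter.Eventually.of_forall fun x => ?_)
    simp only [Function.update_self, fProj]
    rw [integral_mul_const]
  · refine Integrable.of_bound (hmeas.comp hmp.measurable).aestronglyMeasurable (C * B)
      (Filter.Eventually.of_forall fun z => ?_)
    rw [Real.norm_eq_abs, abs_mul]
    exact mul_le_mul (hC _ _) (hB _) (abs_nonneg _) ((abs_nonneg _).trans (hC z.2.1 z.2.2))

lemma integral_kernelTerm_mul_coord
    (hf : Measurable fun z : (Fin k → S) × ({q : Fin k × Fin k // q.1 < q.2} → M) => f z.1 z.2)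
    (hC : ∀ x y, |f x y| ≤ C) {v : Fin k → Fin n} (hv : Function.Injective v) (ℓ : Fin k)
    {h : S → ℝ} (hh : Measurable h) {B : ℝ} (hB : ∀ x, |h x| ≤ B) :
    ∫ z, kernelTerm f v z * h (z.1 (v ℓ)) ∂(graphLaw μ Q n) = ∫ x, fProj f μ Q ℓ x * h x ∂μ := by
  rw [← integral_mul_coord_eq μ Q hf hC ℓ hh hB]
  have hmp := (measurePreserving_pi_comp μ v hv).prod
    (measurePreserving_pi_comp Q (sortPair v hv) (sortPair_injective v hv))
  have hmeas : Measurable fun z : (Fin k → S) × ({q : Fin k × Fin k // q.1 < q.2} → M) =>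
      f z.1 z.2 * h (z.1 ℓ) := hf.mul (hh.comp (by fun_prop))
  rw [graphLaw, graphLaw, ← hmp.map_eq,
    integral_map hmp.measurable.aemeasurable hmeas.aestronglyMeasurable]
  refine integral_congr_ae (Filter.Eventually.of_forall fun z => ?_)
  simp only [kernelTerm, dif_pos hv, Prod.map]

end Projection

section VarianceBound

variable {S M : Type*} [MeasurableSpace S] [MeasurableSpace M] {k n : ℕ}
  {f : (Fin k → S) → ({q : Fin k × Fin k // q.1 < q.2} → M) → ℝ} {C : ℝ}
  (μ : Measure S) [IsProbabilityMeasure μ] (Q : Measure M) [IsProbabilityMeasure Q]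

lemma memLp_two_of_abs_le {Ω : Type*} [MeasurableSpace Ω] {P : Measure Ω} [IsProbabilityMeasure P]
    {F : Ω → ℝ} (hF : Measurable F) {B : ℝ} (hB : ∀ ω, |F ω| ≤ B) : MemLp F 2 P :=
  MemLp.of_bound hF.aestronglyMeasurable B (Filter.Eventually.of_forall hB)

lemma covariance_kernelTerm_coord
    (hf : Measurable fun z : (Fin k → S) × ({q : Fin k × Fin k // q.1 < q.2} → M) => f z.1 z.2)
    (hC : ∀ x y, |f x y| ≤ C) (hC0 : 0 ≤ C) {v : Fin k → Fin n} (hv : Function.Injective v)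
    (ℓ : Fin k) {h : S → ℝ} (hh : Measurable h) {B : ℝ} (hB : ∀ x, |h x| ≤ B) :
    covariance (kernelTerm f v) (fun z => h (z.1 (v ℓ))) (graphLaw μ Q n) =
      covariance (fProj f μ Q ℓ) h μ := by
  have hT := measurable_kernelTerm hf v
  have hcoord : MeasurePreserving (fun z : (Fin n → S) ×
      ({q : Fin n × Fin n // q.1 < q.2} → M) => z.1 (v ℓ)) (graphLaw μ Q n) μ :=
    (measurePreserving_eval (fun _ => μ) (v ℓ)).comp measurePreserving_fst
  have hH : Measurable fun z : (Fin n → S) × ({q : Fin n × Fin n // q.1 < q.2} → M) =>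
      h (z.1 (v ℓ)) := hh.comp hcoord.measurable
  rw [covariance_eq_sub (memLp_two_of_abs_le hT (abs_kernelTerm_le hC hC0 v))
      (memLp_two_of_abs_le hH fun z => hB _),
    covariance_eq_sub (memLp_two_of_abs_le (measurable_fProj μ Q hf ℓ) (abs_fProj_le μ Q hC ℓ))
      (memLp_two_of_abs_le hh hB)]
  have h1 := integral_kernelTerm_mul_coord μ Q hf hC hv ℓ hh hB
  have h2 := integral_kernelTerm_mul_coord μ Q hf hC hv ℓ (h := fun _ => 1) measurable_const
    (B := 1) (fun _ => by simp)
  have h3 : ∫ z, h (z.1 (v ℓ)) ∂(graphLaw μ Q n) = ∫ x, h x ∂μ := by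
    have e := integral_map (μ := graphLaw μ Q n) hcoord.measurable.aemeasurable (f := h)
      hh.aestronglyMeasurable
    rw [hcoord.map_eq] at e
    exact e.symm
  simp only [mul_one] at h2
  simp only [Pi.mul_apply]
  rw [h1, h2, h3]

lemma covariance_kernelTerm_coord_of_notMem
    (hf : Measurable fun z : (Fin k → S) × ({q : Fin k × Fin k // q.1 < q.2} → M) => f z.1 z.2)
    (hC : ∀ x y, |f x y| ≤ C) (hC0 : 0 ≤ C) {v : Fin k → Fin n} {i : Fin n}
    (hi : i ∉ Set.range v) {h : S → ℝ} (hh : Measurable h) {B : ℝ} (hB : ∀ x, |h x| ≤ B) :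
    covariance (kernelTerm f v) (fun z => h (z.1 i)) (graphLaw μ Q n) = 0 := by
  have hT := measurable_kernelTerm hf v
  have hH : Measurable fun z : (Fin n → S) × ({q : Fin n × Fin n // q.1 < q.2} → M) =>
      h (z.1 i) := hh.comp (by fun_prop)
  rw [covariance_eq_sub (memLp_two_of_abs_le hT (abs_kernelTerm_le hC hC0 v))
      (memLp_two_of_abs_le hH fun z => hB _), sub_eq_zero]
  refine integral_mul_of_dependsOn μ Q hT hH (abs_kernelTerm_le hC hC0 v) (fun z => hB _)
    (Set.range v) Set.univ ?_ ?_
  · intro x x' y y' hx hy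
    exact kernelTerm_congr v (fun i => hx _ ⟨i, rfl⟩) fun q _ _ => hy q (Set.mem_univ q)
  · intro x x' y y' hx _
    simp only [hx i hi]

/-- The sum of the first-order projections, whose variance Assumption 1 requires to be positive. -/
noncomputable abbrev projSum (f : (Fin k → S) → ({q : Fin k × Fin k // q.1 < q.2} → M) → ℝ)
    (x : S) : ℝ := ∑ ℓ : Fin k, fProj f μ Q ℓ x

lemma sum_covariance_kernelTerm
    (hf : Measurable fun z : (Fin k → S) × ({q : Fin k × Fin k // q.1 < q.2} → M) => f z.1 z.2)
    (hC : ∀ x y, |f x y| ≤ C) (hC0 : 0 ≤ C) {v : Fin k → Fin n} (hv : Function.Injective v)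
    {h : S → ℝ} (hh : Measurable h) {B : ℝ} (hB : ∀ x, |h x| ≤ B) :
    ∑ i, covariance (kernelTerm f v) (fun z => h (z.1 i)) (graphLaw μ Q n) =
      covariance (projSum μ Q f) h μ := by
  rw [covariance_fun_sum_left
    (fun ℓ => memLp_two_of_abs_le (measurable_fProj μ Q hf ℓ) (abs_fProj_le μ Q hC ℓ))
    (memLp_two_of_abs_le hh hB)]
  simp only [← covariance_kernelTerm_coord μ Q hf hC hC0 hv _ hh hB]
  have := Finset.sum_map Finset.univ (⟨v, hv⟩ : Fin k ↪ Fin n)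
    fun i => covariance (kernelTerm f v) (fun z => h (z.1 i)) (graphLaw μ Q n)
  simp only [Function.Embedding.coeFn_mk] at this
  rw [← this]
  refine (Finset.sum_subset (Finset.subset_univ _) fun i _ hi => ?_).symm
  refine covariance_kernelTerm_coord_of_notMem μ Q hf hC hC0 ?_ hh hB
  rintro ⟨a, rfl⟩
  exact hi (Finset.mem_map.2 ⟨a, Finset.mem_univ _, rfl⟩)

lemma card_filter_injective (k n : ℕ) :
    (Finset.univ.filter fun v : Fin k → Fin n => Function.Injective v).card =
      n.descFactorial k := by
  rw [← Fintype.card_subtype, Fintype.card_congr (Equiv.subtypeInjectiveEquivEmbedding _ _),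
    Fintype.card_embedding_eq, Fintype.card_fin, Fintype.card_fin]

lemma variance_sum_coord {h : S → ℝ} (hh : Measurable h) {B : ℝ} (hB : ∀ x, |h x| ≤ B) :
    variance (fun z => ∑ i, h (z.1 i)) (graphLaw μ Q n) = n * variance h μ := by
  have h1 := variance_sum_pi (μ := fun _ : Fin n => μ) (X := fun _ => h)
    (fun _ => memLp_two_of_abs_le hh hB)
  have hfst : MeasurePreserving (Prod.fst : (Fin n → S) ×
      ({q : Fin n × Fin n // q.1 < q.2} → M) → _) (graphLaw μ Q n) (Measure.pi fun _ => μ) :=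
    measurePreserving_fst
  have hm : Measurable (∑ i : Fin n, fun ω : Fin n → S => h (ω i)) := by
    have : (∑ i : Fin n, fun ω : Fin n → S => h (ω i)) = fun ω => ∑ i, h (ω i) := by
      funext ω
      simp
    rw [this]
    exact Finset.measurable_fun_sum _ fun i _ => hh.comp (measurable_pi_apply i)
  rw [← hfst.map_eq, variance_map (hfst.map_eq ▸ hm.aemeasurable)
    hfst.measurable.aemeasurable] at h1
  simp only [Finset.sum_const, Finset.card_univ, Fintype.card_fin, nsmul_eq_mul] at h1
  rw [← h1]
  congr 1
  funext z
  simp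

/-- Hoeffding-type lower bound for the variance. -/
lemma variance_sum_kernelTerm_ge
    (hf : Measurable fun z : (Fin k → S) × ({q : Fin k × Fin k // q.1 < q.2} → M) => f z.1 z.2)
    (hC : ∀ x y, |f x y| ≤ C) (hC0 : 0 ≤ C) (hn : 0 < n) :
    (n.descFactorial k : ℝ) ^ 2 / n * variance (projSum μ Q f) μ ≤
      variance (fun z => ∑ v, kernelTerm f v z) (graphLaw μ Q n) := by
  set h := projSum μ Q f with hh_def
  have hh : Measurable h := Finset.measurable_fun_sum _ fun ℓ _ => measurable_fProj μ Q hf ℓ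
  have hB : ∀ x, |h x| ≤ k * C := fun x => by
    refine (Finset.abs_sum_le_sum_abs _ _).trans
      ((Finset.sum_le_sum fun ℓ _ => abs_fProj_le μ Q hC ℓ x).trans ?_)
    simp
  have hT2 : ∀ v, MemLp (kernelTerm f v) 2 (graphLaw μ Q n) := fun v =>
    memLp_two_of_abs_le (measurable_kernelTerm hf v) (abs_kernelTerm_le hC hC0 v)
  have hH2 : ∀ i, MemLp (fun z : (Fin n → S) × ({q : Fin n × Fin n // q.1 < q.2} → M) =>
      h (z.1 i)) 2 (graphLaw μ Q n) := fun i =>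
    memLp_two_of_abs_le (hh.comp (by fun_prop)) fun z => hB _
  have hU2 : MemLp (fun z => ∑ v, kernelTerm f v z) 2 (graphLaw μ Q n) :=
    memLp_finsetSum _ fun v _ => hT2 v
  have hL2 : MemLp (fun z : (Fin n → S) × ({q : Fin n × Fin n // q.1 < q.2} → M) =>
      ∑ i, h (z.1 i)) 2 (graphLaw μ Q n) := memLp_finsetSum _ fun i _ => hH2 i
  have hcov : covariance (fun z => ∑ v, kernelTerm f v z) (fun z => ∑ i, h (z.1 i))
      (graphLaw μ Q n) = n.descFactorial k * variance h μ := by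
    rw [covariance_fun_sum_fun_sum hT2 hH2, ← card_filter_injective, ← nsmul_eq_mul,
      ← Finset.sum_const, Finset.sum_filter]
    refine Finset.sum_congr rfl fun v _ => ?_
    split_ifs with hv
    · rw [sum_covariance_kernelTerm μ Q hf hC hC0 hv hh hB, covariance_self hh.aemeasurable]
    · have : kernelTerm f v = fun _ : (Fin n → S) ×
          ({q : Fin n × Fin n // q.1 < q.2} → M) => (0 : ℝ) := by
        funext z
        rw [kernelTerm, dif_neg hv]
      rw [this]
      simp [covariance_const_left]
  have hvarL := variance_sum_coord (n := n) μ Q hh hB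
  have hn' : (0 : ℝ) < n := by exact_mod_cast hn
  have hnonneg := variance_nonneg (fun z => (∑ v, kernelTerm f v z) -
    (n.descFactorial k / n : ℝ) * ∑ i, h (z.1 i)) (graphLaw μ Q n)
  rw [variance_fun_sub hU2 (hL2.const_mul _), covariance_const_mul_right, hcov,
    variance_const_mul, hvarL] at hnonneg
  have : (n.descFactorial k : ℝ) ^ 2 / n * variance h μ =
      2 * ((n.descFactorial k / n : ℝ) * (n.descFactorial k * variance h μ)) -
        (n.descFactorial k / n : ℝ) ^ 2 * (n * variance h μ) := by
    field_simp
    ring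
  rw [this]
  linarith

end VarianceBound

/-- The centred summand of the generalized U-statistic, divided by `s`. -/
noncomputable def centredTerm {S M : Type*} [MeasurableSpace S] [MeasurableSpace M] {k n : ℕ}
    (f : (Fin k → S) → ({q : Fin k × Fin k // q.1 < q.2} → M) → ℝ) (μ : Measure S)
    (Q : Measure M) (s : ℝ) (v : Fin k → Fin n)
    (z : (Fin n → S) × ({q : Fin n × Fin n // q.1 < q.2} → M)) : ℝ :=
  (kernelTerm f v z - ∫ z', kernelTerm f v z' ∂(graphLaw μ Q n)) / s

section Centred

variable {S M : Type*} [MeasurableSpace S] [MeasurableSpace M] {k n : ℕ}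
  {f : (Fin k → S) → ({q : Fin k × Fin k // q.1 < q.2} → M) → ℝ} {C : ℝ}
  (μ : Measure S) [IsProbabilityMeasure μ] (Q : Measure M) [IsProbabilityMeasure Q]

lemma abs_centredTerm_le (hC : ∀ x y, |f x y| ≤ C) (hC0 : 0 ≤ C) {s : ℝ} (hs : 0 ≤ s)
    (v : Fin k → Fin n) (z : (Fin n → S) × ({q : Fin n × Fin n // q.1 < q.2} → M)) :
    |centredTerm f μ Q s v z| ≤ 2 * C / s := by
  have h1 := abs_kernelTerm_le hC hC0 v z
  have h2 : |∫ z', kernelTerm f v z' ∂(graphLaw μ Q n)| ≤ C := by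
    have := norm_integral_le_of_norm_le_const (μ := graphLaw μ Q n) (f := kernelTerm f v) (C := C)
      (Filter.Eventually.of_forall fun z => abs_kernelTerm_le hC hC0 v z)
    exact this.trans_eq (by simp)
  rw [centredTerm, abs_div, abs_of_nonneg hs]
  refine div_le_div_of_nonneg_right ?_ hs
  exact (abs_sub _ _).trans (by linarith)

lemma cumulantSum_centredTerm_eq_zero {ι : Type*} [Fintype ι] [DecidableEq ι]
    (hf : Measurable fun z : (Fin k → S) × ({q : Fin k × Fin k // q.1 < q.2} → M) => f z.1 z.2)
    (hC : ∀ x y, |f x y| ≤ C) (hC0 : 0 ≤ C) {s : ℝ} (hs : 0 ≤ s) (β : ι → Fin k → Fin n)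
    (hβ : ¬ ConnectedFamily Meets β) :
    cumulantSum (fun b : Finset ι =>
      ∫ z, ∏ i ∈ b, centredTerm f μ Q s (β i) z ∂(graphLaw μ Q n)) = 0 := by
  classical
  simp only [ConnectedFamily, not_forall, not_exists, not_and] at hβ
  obtain ⟨p, ⟨i₀, hi₀⟩, ⟨i₁, hi₁⟩, hsep⟩ := hβ
  have hmeas : ∀ v : Fin k → Fin n, Measurable (centredTerm f μ Q s v) := fun v =>
    ((measurable_kernelTerm hf v).sub_const _).div_const _
  have hbd : ∀ (v : Fin k → Fin n) z, |centredTerm f μ Q s v z| ≤ 2 * C / s :=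
    abs_centredTerm_le μ Q hC hC0 hs
  let U : Set (Fin n) := {a | ∃ i, p i ∧ a ∈ Set.range (β i)}
  refine cumulantSum_eq_zero_of_factor p ⟨i₀, hi₀⟩ ⟨i₁, hi₁⟩ _
    (fun b => ∫ z, ∏ i ∈ b, centredTerm f μ Q s (β i) z ∂(graphLaw μ Q n))
    (fun b => ∫ z, ∏ i ∈ b, centredTerm f μ Q s (β i) z ∂(graphLaw μ Q n))
    (by simp) (by simp) fun b => ?_
  rw [← integral_mul_of_dependsOn μ Q
    (F := fun z => ∏ i ∈ b.subtype p, centredTerm f μ Q s (β i) z)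
    (G := fun z => ∏ i ∈ b.subtype fun i => ¬ p i, centredTerm f μ Q s (β i) z)
    (Finset.measurable_fun_prod _ fun i _ => hmeas _)
    (Finset.measurable_fun_prod _ fun i _ => hmeas _)
    (fun z => abs_prod_le_pow _ _ fun i => hbd _ z)
    (fun z => abs_prod_le_pow _ _ fun i => hbd _ z) U {q | q.1.1 ∈ U ∧ q.1.2 ∈ U}]
  · refine integral_congr_ae (Filter.Eventually.of_forall fun z => ?_)
    simp only
    rw [Finset.prod_subtype_eq_prod_filter (s := b) (p := p)
        (fun i => centredTerm f μ Q s (β i) z),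
      Finset.prod_subtype_eq_prod_filter (s := b) (p := fun i => ¬ p i)
        (fun i => centredTerm f μ Q s (β i) z), Finset.prod_filter_mul_prod_filter_not]
  · intro x x' y y' hx hy
    refine Finset.prod_congr rfl fun i _ => ?_
    simp only [centredTerm]
    rw [kernelTerm_congr (β i) (fun a => hx _ ⟨i, i.2, a, rfl⟩)
      fun q h1 h2 => hy q ⟨⟨i, i.2, h1⟩, ⟨i, i.2, h2⟩⟩]
  · intro x x' y y' hx hy
    refine Finset.prod_congr rfl fun i _ => ?_
    have hnot : ∀ a ∈ Set.range (β i), a ∉ U := by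
      rintro _ ⟨a, rfl⟩ ⟨i', hi', a', ha'⟩
      exact hsep i' i hi' i.2 ⟨a', a, ha'⟩
    simp only [centredTerm]
    rw [kernelTerm_congr (β i) (fun a => hx _ (hnot _ ⟨a, rfl⟩))
      fun q h1 _ => hy q fun hq => hnot _ h1 hq.1]

/-- Cumulant bound on the canonical space. -/
lemma abs_cumulantSum_centred_le
    (hf : Measurable fun z : (Fin k → S) × ({q : Fin k × Fin k // q.1 < q.2} → M) => f z.1 z.2)
    (hC : ∀ x y, |f x y| ≤ C) (hC0 : 0 ≤ C) {s : ℝ} (hs : 0 ≤ s) (m : ℕ) :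
    |cumulantSum (fun b : Finset (Fin (m + 1)) =>
      ∫ z, ∏ _i ∈ b, ∑ v, centredTerm f μ Q s v z ∂(graphLaw μ Q n))| ≤
      ((m + 1).factorial * ((n : ℝ) ^ k * (k ^ 2 * n ^ (k - 1)) ^ m * m.factorial)) *
        (((m + 1 : ℕ) : ℝ) ^ (m + 1) * (2 * C / s) ^ (m + 1)) := by
  classical
  have hmeas : ∀ v : Fin k → Fin n, Measurable (centredTerm f μ Q s v) := fun v =>
    ((measurable_kernelTerm hf v).sub_const _).div_const _
  rw [cumulantSum_sum_expand _ _ hmeas (abs_centredTerm_le μ Q hC hC0 hs)]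
  have hterm : ∀ β : Fin (m + 1) → Fin k → Fin n, |cumulantSum (fun b : Finset (Fin (m + 1)) =>
      ∫ z, ∏ i ∈ b, centredTerm f μ Q s (β i) z ∂(graphLaw μ Q n))| ≤
      ((m + 1 : ℕ) : ℝ) ^ (m + 1) * (2 * C / s) ^ (m + 1) := by
    intro β
    have h := abs_cumulantSum_le (fun b : Finset (Fin (m + 1)) =>
      ∫ z, ∏ i ∈ b, centredTerm f μ Q s (β i) z ∂(graphLaw μ Q n)) (A := 2 * C / s) fun b => by
        have := norm_integral_le_of_norm_le_const (μ := graphLaw μ Q n)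
          (f := fun z => ∏ i ∈ b, centredTerm f μ Q s (β i) z) (C := (2 * C / s) ^ b.card)
          (Filter.Eventually.of_forall fun z =>
            abs_prod_le_pow b _ fun i => abs_centredTerm_le μ Q hC hC0 hs (β i) z)
        exact this.trans_eq (by simp)
    simpa only [Fintype.card_fin] using h
  have hcount : ((Finset.univ.filter fun β : Fin (m + 1) → Fin k → Fin n =>
      ConnectedFamily Meets β).card : ℝ) ≤
      (m + 1).factorial * ((n : ℝ) ^ k * (k ^ 2 * n ^ (k - 1)) ^ m * m.factorial) := by
    have h := card_connectedFamily_le (Meets (k := k) (n := n)) card_meets_le m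
    simp only [Fintype.card_fun, Fintype.card_fin] at h
    have h' := (Nat.cast_le (α := ℝ)).2 h
    push_cast at h'
    exact h'
  refine (Finset.abs_sum_le_sum_abs _ _).trans ?_
  rw [← Finset.sum_filter_add_sum_filter_not Finset.univ
    (fun β : Fin (m + 1) → Fin k → Fin n => ConnectedFamily Meets β),
    Finset.sum_eq_zero (s := Finset.univ.filter fun β : Fin (m + 1) → Fin k → Fin n =>
      ¬ ConnectedFamily Meets β) fun β hβ => by
        rw [cumulantSum_centredTerm_eq_zero μ Q hf hC hC0 hs β (Finset.mem_filter.1 hβ).2,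
          abs_zero], add_zero]
  refine (Finset.sum_le_sum fun β _ => hterm β).trans ?_
  rw [Finset.sum_const, nsmul_eq_mul]
  exact mul_le_mul_of_nonneg_right hcount (by positivity)

end Centred

lemma pow_self_le_exp_pow_mul_factorial (j : ℕ) :
    (j : ℝ) ^ j ≤ Real.exp 1 ^ j * j.factorial := by
  have h := Real.pow_div_factorial_le_exp (x := (j : ℝ)) (Nat.cast_nonneg j) j
  rw [div_le_iff₀ (by positivity)] at h
  rwa [← Real.exp_nat_mul, mul_one]

lemma cumulant_numeric_bound {k p : ℕ} (hk : 2 ≤ k) (hp : 1 ≤ p) {r a A B : ℝ} (hr : 0 < r)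
    (ha : 0 ≤ a) (hA0 : 0 ≤ A) (hA : A ≤ a / r ^ (2 * k - 1)) (hB1 : 1 ≤ B)
    (hB : Real.exp 1 * k ^ 2 * a ≤ B) :
    ((p + 2).factorial * ((r ^ 2) ^ k * (k ^ 2 * (r ^ 2) ^ (k - 1)) ^ (p + 1) *
      (p + 1).factorial)) * (((p + 2 : ℕ) : ℝ) ^ (p + 2) * A ^ (p + 2)) ≤
      ((p + 2).factorial : ℝ) ^ (k + 1) /
        (r ^ 2 * (B ^ 6)⁻¹) ^ (((p + 2 : ℕ) : ℝ) / 2 - 1) := by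
  have hBpos : 0 < B := by linarith
  have hk1 : (1 : ℝ) ≤ k := by exact_mod_cast (by omega : 1 ≤ k)
  have hden : (r ^ 2 * (B ^ 6)⁻¹) ^ (((p + 2 : ℕ) : ℝ) / 2 - 1) = (r / B ^ 3) ^ p := by
    have h1 : r ^ 2 * (B ^ 6)⁻¹ = (r / B ^ 3) ^ (2 : ℝ) := by
      rw [Real.rpow_two]
      field_simp
    have h2 : (2 : ℝ) * (((p + 2 : ℕ) : ℝ) / 2 - 1) = p := by
      push_cast
      ring
    rw [h1, ← Real.rpow_mul (by positivity), h2, Real.rpow_natCast]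
  set F : ℝ := ((p + 2).factorial : ℝ) with hF
  have hF1 : 1 ≤ F := by rw [hF]; exact_mod_cast Nat.factorial_pos (p + 2)
  have hF' : ((p + 1).factorial : ℝ) ≤ F := by
    rw [hF]
    exact_mod_cast Nat.factorial_le (by omega : p + 1 ≤ p + 2)
  have hpow : (r ^ 2) ^ k * ((r ^ 2) ^ (k - 1)) ^ (p + 1) * r ^ p =
      (r ^ (2 * k - 1)) ^ (p + 2) := by
    obtain ⟨l, rfl⟩ : ∃ l, k = l + 1 := ⟨k - 1, by omega⟩
    rw [show 2 * (l + 1) - 1 = 2 * l + 1 by omega, Nat.add_sub_cancel]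
    ring
  have hAr : A ^ (p + 2) * (r ^ (2 * k - 1)) ^ (p + 2) ≤ a ^ (p + 2) := by
    rw [← mul_pow]
    refine pow_le_pow_left₀ (by positivity) ?_ _
    rwa [le_div_iff₀ (by positivity)] at hA
  have hBpow : (Real.exp 1 * k ^ 2 * a) ^ (p + 2) ≤ B ^ (3 * p) :=
    (pow_le_pow_left₀ (by positivity) hB _).trans (pow_le_pow_right₀ hB1 (by omega))
  have hkpow : ((k : ℝ) ^ 2) ^ (p + 1) ≤ (k ^ 2) ^ (p + 2) :=
    pow_le_pow_right₀ (one_le_pow₀ hk1) (by omega)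
  rw [hden, div_pow, ← pow_mul, le_div_iff₀ (by positivity), mul_div_assoc',
    div_le_iff₀ (by positivity)]
  calc _ = F * (p + 1).factorial * ((k : ℝ) ^ 2) ^ (p + 1) * ((p + 2 : ℕ) : ℝ) ^ (p + 2) *
        (A ^ (p + 2) * ((r ^ 2) ^ k * ((r ^ 2) ^ (k - 1)) ^ (p + 1) * r ^ p)) := by
        rw [mul_pow]; ring
    _ ≤ F * F * ((k : ℝ) ^ 2) ^ (p + 2) * (Real.exp 1 ^ (p + 2) * F) * a ^ (p + 2) := by
        rw [hpow]
        have := pow_self_le_exp_pow_mul_factorial (p + 2)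
        gcongr
    _ = F ^ 3 * (Real.exp 1 * k ^ 2 * a) ^ (p + 2) := by rw [mul_pow, mul_pow]; ring
    _ ≤ F ^ (k + 1) * B ^ (3 * p) :=
        mul_le_mul (pow_le_pow_right₀ hF1 (by omega)) hBpow (by positivity) (by positivity)
    _ = F ^ (k + 1) * (B ^ 3) ^ p := by rw [pow_mul]

/-- Cumulant bound for the normalized generalized U-statistic: under Assumption 1, there is
`C̃(f,k) > 0` such that for all `n ≥ 4(k−1)` and `j ≥ 3`,
`κ_j(S̄_{n,k}(f)) ≤ (j!)^{k+1}/(n C̃(f,k))^{j/2−1}`. -/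
theorem cumulant_bound_genUbar {S M : Type*} [MeasurableSpace S] [MeasurableSpace M]
    {k : ℕ} (hk : 2 ≤ k)
    (μ : Measure S) [IsProbabilityMeasure μ] (hμ : ∀ x, μ {x} = 0)
    (Q : Measure M) [IsProbabilityMeasure Q]
    (Ω : ℕ → Type) [∀ n, MeasurableSpace (Ω n)]
    (P : ∀ n, Measure (Ω n)) [∀ n, IsProbabilityMeasure (P n)]
    (X : ∀ n, Fin n → Ω n → S) (Y : ∀ n, Fin n → Fin n → Ω n → M)
    (hYsym : ∀ n a b, Y n a b = Y n b a)
    (hlaw : ∀ n, Measure.map (fun ω => ((fun i => X n i ω),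
        (fun q : {q : Fin n × Fin n // q.1 < q.2} => Y n q.1.1 q.1.2 ω))) (P n)
      = (Measure.pi fun _ => μ).prod (Measure.pi fun _ => Q))
    (f : (Fin k → S) → ({q : Fin k × Fin k // q.1 < q.2} → M) → ℝ)
    (hf : Measurable fun z : (Fin k → S) × ({q : Fin k × Fin k // q.1 < q.2} → M) =>
      f z.1 z.2)
    (C : ℝ) (hC : ∀ x y, |f x y| ≤ C)
    (hA : 0 < variance (fun x => ∑ ℓ : Fin k, fProj f μ Q ℓ x) μ) :
    ∃ Ct > (0 : ℝ), ∀ n, 4 * (k - 1) ≤ n → ∀ j, 3 ≤ j →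
      cum (P n) j (genUbar (P n) f (X n) (Y n))
        ≤ (j.factorial : ℝ) ^ (k + 1) / ((n : ℝ) * Ct) ^ ((j : ℝ) / 2 - 1) := by
  obtain ⟨x₀⟩ : Nonempty S := nonempty_of_isProbabilityMeasure μ
  obtain ⟨y₀⟩ : Nonempty M := nonempty_of_isProbabilityMeasure Q
  have hC0 : 0 ≤ C := (abs_nonneg _).trans (hC (fun _ => x₀) fun _ => y₀)
  set σ2 := variance (projSum μ Q f) μ with hσ2
  set c : ℝ := (3 / 4) ^ (2 * k) * σ2 with hc
  have hcpos : 0 < c := mul_pos (by positivity) hA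
  set a : ℝ := 2 * C / Real.sqrt c with ha
  have ha0 : 0 ≤ a := by positivity
  set B : ℝ := max 1 (Real.exp 1 * k ^ 2 * a) with hB
  have hB1 : 1 ≤ B := le_max_left _ _
  have hBpos : 0 < B := by linarith
  refine ⟨(B ^ 6)⁻¹, by positivity, fun n hn j hj => ?_⟩
  have hn0 : 0 < n := by omega
  have hn0' : (0 : ℝ) < n := by exact_mod_cast hn0
  obtain ⟨p, rfl⟩ : ∃ p, j = p + 2 := ⟨j - 2, by omega⟩
  set T : Ω n → (Fin n → S) × ({q : Fin n × Fin n // q.1 < q.2} → M) :=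
    fun ω => ((fun i => X n i ω),
      (fun q : {q : Fin n × Fin n // q.1 < q.2} => Y n q.1.1 q.1.2 ω)) with hT
  have hlaw' : Measure.map T (P n) = graphLaw μ Q n := hlaw n
  have hTm : AEMeasurable T (P n) := AEMeasurable.of_map_ne_zero (by
    rw [hlaw']
    exact IsProbabilityMeasure.ne_zero _)
  have hgen : genU f (X n) (Y n) = fun ω => ∑ v, kernelTerm f v (T ω) :=
    funext fun ω => genU_eq_sum_kernelTerm f (X n) (Y n) (hYsym n) ω
  have hsum : Measurable fun z : (Fin n → S) × ({q : Fin n × Fin n // q.1 < q.2} → M) =>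
      ∑ v, kernelTerm f v z := Finset.measurable_fun_sum _ fun v _ => measurable_kernelTerm hf v
  set s := Real.sqrt (variance (genU f (X n) (Y n)) (P n)) with hs
  have hs0 : 0 ≤ s := Real.sqrt_nonneg _
  have hvar : variance (genU f (X n) (Y n)) (P n) =
      variance (fun z => ∑ v, kernelTerm f v z) (graphLaw μ Q n) := by
    rw [hgen, ← hlaw', variance_map hsum.aemeasurable hTm]
    rfl
  have hmean : ∫ ω, genU f (X n) (Y n) ω ∂(P n) =
      ∑ v, ∫ z, kernelTerm f v z ∂(graphLaw μ Q n) := by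
    rw [hgen, ← integral_finsetSum, ← hlaw', integral_map hTm hsum.aestronglyMeasurable]
    exact fun v _ => (memLp_two_of_abs_le (measurable_kernelTerm hf v)
      (abs_kernelTerm_le hC hC0 v)).integrable one_le_two
  have hbar : genUbar (P n) f (X n) (Y n) = fun ω => ∑ v, centredTerm f μ Q s v (T ω) := by
    funext ω
    simp only [genUbar, centredTerm]
    rw [hmean, ← hs, hgen, ← Finset.sum_div, Finset.sum_sub_distrib]
  have hcent : Measurable fun z : (Fin n → S) × ({q : Fin n × Fin n // q.1 < q.2} → M) =>
      ∑ v, centredTerm f μ Q s v z := Finset.measurable_fun_sum _ fun v _ =>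
    ((measurable_kernelTerm hf v).sub_const _).div_const _
  have hcum : cum (P n) (p + 2) (genUbar (P n) f (X n) (Y n)) =
      cumulantSum (fun b : Finset (Fin (p + 1 + 1)) =>
        ∫ z, ∏ _i ∈ b, ∑ v, centredTerm f μ Q s v z ∂(graphLaw μ Q n)) := by
    have : ∀ b : Finset (Fin (p + 2)),
        ∫ ω, ∏ _i ∈ b, genUbar (P n) f (X n) (Y n) ω ∂(P n) =
          ∫ z, ∏ _i ∈ b, ∑ v, centredTerm f μ Q s v z ∂(graphLaw μ Q n) := by
      intro b
      rw [hbar, ← hlaw', integral_map hTm]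
      exact (Finset.measurable_fun_prod _ fun _ _ => hcent).aestronglyMeasurable
    simp only [cum, jointCumulant, cumulantSum, this]
  have hvarge : c * (n : ℝ) ^ (2 * k - 1) ≤ variance (genU f (X n) (Y n)) (P n) := by
    rw [hvar]
    refine le_trans ?_ (variance_sum_kernelTerm_ge μ Q hf hC hC0 hn0)
    have hdesc : (3 / 4 * (n : ℝ)) ^ k ≤ (n.descFactorial k : ℝ) := by
      have h1 : ((n + 1 - k : ℕ) : ℝ) ^ k ≤ (n.descFactorial k : ℝ) := by
        exact_mod_cast Nat.pow_sub_le_descFactorial n k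
      refine (pow_le_pow_left₀ (by positivity) ?_ k).trans h1
      have h2 : 3 * n ≤ 4 * (n + 1 - k) := by omega
      have h3 : (3 : ℝ) * n ≤ 4 * ((n + 1 - k : ℕ) : ℝ) := by exact_mod_cast h2
      linarith
    have hpow : (n : ℝ) ^ (2 * k - 1) = ((n : ℝ) ^ k) ^ 2 / n := by
      rw [eq_div_iff hn0'.ne', ← pow_succ, ← pow_mul]
      congr 1
      omega
    calc c * (n : ℝ) ^ (2 * k - 1) = ((3 / 4 * (n : ℝ)) ^ k) ^ 2 / n * σ2 := by
          rw [hpow, hc, mul_pow, mul_pow, pow_mul']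
          ring
      _ ≤ (n.descFactorial k : ℝ) ^ 2 / n * σ2 := by
          have : 0 ≤ σ2 := hA.le
          gcongr
  have hr : 0 < Real.sqrt n := Real.sqrt_pos.2 hn0'
  have hsge : Real.sqrt c * Real.sqrt n ^ (2 * k - 1) ≤ s := by
    have h1 : Real.sqrt c * Real.sqrt n ^ (2 * k - 1) =
        Real.sqrt (c * (n : ℝ) ^ (2 * k - 1)) := by
      rw [Real.sqrt_mul hcpos.le]
      congr 1
      symm
      rw [Real.sqrt_eq_iff_eq_sq (by positivity) (by positivity), pow_right_comm,
        Real.sq_sqrt hn0'.le]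
    rw [h1]
    exact Real.sqrt_le_sqrt hvarge
  have hApos : 0 < Real.sqrt c * Real.sqrt n ^ (2 * k - 1) :=
    mul_pos (Real.sqrt_pos.2 hcpos) (by positivity)
  have hAle : 2 * C / s ≤ a / Real.sqrt n ^ (2 * k - 1) := by
    rw [ha, div_div]
    exact div_le_div_of_nonneg_left (by positivity) hApos hsge
  have hnum := cumulant_numeric_bound hk (by omega : 1 ≤ p) hr ha0
    (by positivity : 0 ≤ 2 * C / s) hAle hB1 (le_max_right _ _)
  rw [Real.sq_sqrt hn0'.le] at hnum
  rw [hcum]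
  exact (le_abs_self _).trans
    ((abs_cumulantSum_centred_le μ Q hf hC hC0 hs0 (p + 1)).trans hnum)
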